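/- arXiv:2502.01554 — 3 statements merged into one kernel-verified Lean document; each statement's English description precedes it below -/
import Mathlib

section
/- Let f be a bounded measurable real-valued function on the circle S¹ with f ≥ 0 almost everywhere and f not equal to 0 almost everywhere, and let a_j be its Fourier coefficients. Then the smallest eigenvalue of the Hermitian Toeplitz matrix T_k[a] decays at most exponentially as k → ∞: there exist c > 0 and k₀ ∈ ℕ such that for every k ≥ k₀, λ_min(T_k[a]) ≥ exp(−c·k). -/
open MeasureTheory Matrix

/-- The `j`-th Fourier coefficient `a_j = (1/2π) ∫₀^{2π} f(θ) e^{-ijθ} dθ` of a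
real-valued function on the circle `ℝ/2πℤ`. -/
noncomputable def fourierCoefR (f : ℝ → ℝ) (j : ℤ) : ℂ :=
  (1 / (2 * (Real.pi : ℂ))) *
    ∫ θ in (0 : ℝ)..(2 * Real.pi), (f θ : ℂ) * Complex.exp (-(Complex.I * (j : ℂ) * (θ : ℂ)))

/-- The `(k+1) × (k+1)` Toeplitz matrix `(a_{p-q})_{0 ≤ p,q ≤ k}` associated with the
Fourier coefficients of `f`. -/
noncomputable def toeplitzMatR (f : ℝ → ℝ) (k : ℕ) :
    Matrix (Fin (k + 1)) (Fin (k + 1)) ℂ :=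
  Matrix.of fun p q => fourierCoefR f ((p : ℤ) - (q : ℤ))

/-- The smallest eigenvalue of a Hermitian matrix, expressed as the infimum of the
Rayleigh quotient over the unit sphere. -/
noncomputable def lambdaMin {n : ℕ} (M : Matrix (Fin n) (Fin n) ℂ) : ℝ :=
  sInf {t : ℝ | ∃ v : Fin n → ℂ, (∑ i, ‖v i‖ ^ 2) = 1 ∧
    t = (dotProduct (star v) (M.mulVec v)).re}

/-- The polynomial with coefficient vector `v`. -/
noncomputable def vecPoly {k : ℕ} (v : Fin (k + 1) → ℂ) : Polynomial ℂ :=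
  ∑ i : Fin (k + 1), Polynomial.C (v i) * Polynomial.X ^ (i : ℕ)

lemma vecPoly_coeff {k : ℕ} (v : Fin (k + 1) → ℂ) (i : Fin (k + 1)) :
    (vecPoly v).coeff i = v i := by
  simp only [vecPoly, Polynomial.finsetSum_coeff, Polynomial.coeff_C_mul_X_pow]
  rw [Finset.sum_eq_single i]
  · simp
  · intro b _ hb
    rw [if_neg]
    intro h
    exact hb (Fin.ext h.symm)
  · simp

lemma vecPoly_natDegree {k : ℕ} (v : Fin (k + 1) → ℂ) : (vecPoly v).natDegree ≤ k := by
  refine Polynomial.natDegree_sum_le_of_forall_le _ _ fun i _ => ?_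
  exact (Polynomial.natDegree_C_mul_X_pow_le _ _).trans (Nat.lt_succ_iff.mp i.2)

lemma vecPoly_eval {k : ℕ} (v : Fin (k + 1) → ℂ) (z : ℂ) :
    (vecPoly v).eval z = ∑ i, v i * z ^ (i : ℕ) := by
  simp [vecPoly, Polynomial.eval_finsetSum]

lemma integrand_int (f : ℝ → ℝ) (hmeas : Measurable f)
    (hbd : ∃ C : ℝ, ∀ θ : ℝ, |f θ| ≤ C) (g : ℝ → ℂ) (hg : Continuous g) :
    IntervalIntegrable (fun θ => (f θ : ℂ) * g θ) volume 0 (2 * Real.pi) := by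
  obtain ⟨C, hC⟩ := hbd
  refine IntervalIntegrable.mul_continuousOn ?_ hg.continuousOn
  rw [intervalIntegrable_iff]
  refine MeasureTheory.Measure.integrableOn_of_bounded (M := C) measure_Ioc_lt_top.ne ?_ ?_
  · exact (Complex.measurable_ofReal.comp hmeas).aestronglyMeasurable
  · filter_upwards with x
    simpa using hC x

lemma form_eq (f : ℝ → ℝ) (hmeas : Measurable f)
    (hbd : ∃ C : ℝ, ∀ θ : ℝ, |f θ| ≤ C) {k : ℕ} (v : Fin (k + 1) → ℂ) :
    (dotProduct (star v) ((toeplitzMatR f k).mulVec v)).re =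
      (2 * Real.pi)⁻¹ * ∫ θ in (0 : ℝ)..(2 * Real.pi),
        f θ * ‖(vecPoly v).eval (circleMap 0 1 θ)‖ ^ 2 := by
  have key : dotProduct (star v) ((toeplitzMatR f k).mulVec v) =
      ((2 * Real.pi)⁻¹ * ∫ θ in (0 : ℝ)..(2 * Real.pi),
        f θ * ‖(vecPoly v).eval (circleMap 0 1 θ)‖ ^ 2 : ℝ) := by
    have h1 : ∀ θ : ℝ, ((f θ * ‖(vecPoly v).eval (circleMap 0 1 θ)‖ ^ 2 : ℝ) : ℂ) =
        ∑ p : Fin (k + 1), ∑ q : Fin (k + 1), (star (v p) * v q) *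
          ((f θ : ℂ) * Complex.exp (-(Complex.I * (((p : ℤ) - (q : ℤ) : ℤ) : ℂ) * (θ : ℂ)))) := by
      intro θ
      have hz : ((‖(vecPoly v).eval (circleMap 0 1 θ)‖ ^ 2 : ℝ) : ℂ) =
          star ((vecPoly v).eval (circleMap 0 1 θ)) * (vecPoly v).eval (circleMap 0 1 θ) := by
        rw [Complex.ofReal_pow, ← Complex.conj_mul']; rfl
      rw [Complex.ofReal_mul, hz, vecPoly_eval, star_sum, Finset.sum_mul_sum, Finset.mul_sum]
      refine Finset.sum_congr rfl fun p _ => ?_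
      rw [Finset.mul_sum]
      refine Finset.sum_congr rfl fun q _ => ?_
      have : star (circleMap 0 1 θ ^ (p : ℕ)) * circleMap 0 1 θ ^ (q : ℕ) =
          Complex.exp (-(Complex.I * (((p : ℤ) - (q : ℤ) : ℤ) : ℂ) * (θ : ℂ))) := by
        simp only [circleMap, zero_add, Complex.ofReal_one, one_mul, star_pow]
        rw [show star (Complex.exp (θ * Complex.I)) = Complex.exp (-(θ * Complex.I)) by
          rw [Complex.star_def, ← Complex.exp_conj]; simp]
        rw [← Complex.exp_nat_mul, ← Complex.exp_nat_mul, ← Complex.exp_add]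
        congr 1
        push_cast
        ring
      rw [← this, star_mul']
      ring
    rw [Complex.ofReal_mul, ← intervalIntegral.integral_ofReal]
    simp_rw [h1]
    have hTermInt : ∀ p q : Fin (k + 1), IntervalIntegrable (fun θ : ℝ => (star (v p) * v q) *
          ((f θ : ℂ) * Complex.exp (-(Complex.I * (((p : ℤ) - (q : ℤ) : ℤ) : ℂ) * (θ : ℂ)))))
          volume 0 (2 * Real.pi) := fun p q =>
      (integrand_int f hmeas hbd _ (by fun_prop)).const_mul _
    have hInnerInt : ∀ p : Fin (k + 1), IntervalIntegrable (fun θ : ℝ => ∑ q : Fin (k + 1),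
          (star (v p) * v q) *
          ((f θ : ℂ) * Complex.exp (-(Complex.I * (((p : ℤ) - (q : ℤ) : ℤ) : ℂ) * (θ : ℂ)))))
          volume 0 (2 * Real.pi) := by
      intro p
      have := IntervalIntegrable.sum Finset.univ (fun q _ => hTermInt p q)
      rw [Finset.sum_fn] at this
      exact this
    rw [intervalIntegral.integral_finsetSum (fun p _ => hInnerInt p), Finset.mul_sum]
    simp only [dotProduct, mulVec, toeplitzMatR, Matrix.of_apply, fourierCoefR]
    refine Finset.sum_congr rfl fun p _ => ?_
    rw [intervalIntegral.integral_finsetSum (fun q _ => hTermInt p q), Finset.mul_sum, Finset.mul_sum]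
    refine Finset.sum_congr rfl fun q _ => ?_
    rw [intervalIntegral.integral_const_mul]
    push_cast
    simp only [Pi.star_apply]
    ring
  rw [key, Complex.ofReal_re]

lemma log_bounds {k : ℕ} (v : Fin (k + 1) → ℂ) (hv : (∑ i, ‖v i‖ ^ 2) = 1) :
    vecPoly v ≠ 0 ∧
    (∀ θ : ℝ, Real.log ‖(vecPoly v).eval (circleMap 0 1 θ)‖ ≤ k * Real.log 2) ∧
    -(4 * Real.pi * (k * Real.log 2)) ≤
      ∫ θ in (0 : ℝ)..(2 * Real.pi), Real.log ‖(vecPoly v).eval (circleMap 0 1 θ)‖ := by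
  have hle : ∀ i, ‖v i‖ ≤ 1 := by
    intro i
    have : ‖v i‖ ^ 2 ≤ 1 := by
      rw [← hv]
      exact Finset.single_le_sum (f := fun i => ‖v i‖ ^ 2) (fun j _ => by positivity)
        (Finset.mem_univ i)
    exact (sq_le_one_iff₀ (norm_nonneg _)).mp this
  have hk2 : ((k : ℝ) + 1) ≤ 2 ^ k := by
    exact_mod_cast Nat.lt_two_pow_self (n := k)
  have hsum : 1 ≤ ∑ i, ‖v i‖ := by
    rw [← hv]
    refine Finset.sum_le_sum fun i _ => ?_
    nlinarith [hle i, norm_nonneg (v i)]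
  have hM : 1 ≤ 4 ^ k * (vecPoly v).mahlerMeasure := by
    have hM0 := (vecPoly v).mahlerMeasure_nonneg
    calc (1 : ℝ) ≤ ∑ i, ‖v i‖ := hsum
      _ ≤ ∑ i : Fin (k + 1), 2 ^ k * (vecPoly v).mahlerMeasure := by
        refine Finset.sum_le_sum fun i _ => ?_
        have h := (vecPoly v).norm_coeff_le_choose_mul_mahlerMeasure i
        rw [vecPoly_coeff] at h
        refine h.trans (mul_le_mul_of_nonneg_right ?_ hM0)
        have h2 : (vecPoly v).natDegree.choose i ≤ 2 ^ k :=
          (Nat.choose_le_two_pow _ _).trans (Nat.pow_le_pow_right (by norm_num)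
            (vecPoly_natDegree v))
        exact_mod_cast h2
      _ = ((k : ℝ) + 1) * (2 ^ k * (vecPoly v).mahlerMeasure) := by simp
      _ ≤ 2 ^ k * (2 ^ k * (vecPoly v).mahlerMeasure) := by gcongr
      _ = 4 ^ k * (vecPoly v).mahlerMeasure := by
        rw [← mul_assoc, ← mul_pow]; norm_num
  have hp0 : vecPoly v ≠ 0 := by
    intro h
    rw [h] at hM
    simp at hM
    linarith
  refine ⟨hp0, fun θ => ?_, ?_⟩
  · have hn : ‖(vecPoly v).eval (circleMap 0 1 θ)‖ ≤ 2 ^ k := by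
      rw [vecPoly_eval]
      calc _ ≤ ∑ i : Fin (k + 1), (1 : ℝ) := by
            refine norm_sum_le_of_le _ fun i _ => ?_
            simpa using hle i
        _ = (k : ℝ) + 1 := by simp
        _ ≤ 2 ^ k := hk2
    rcases (norm_nonneg ((vecPoly v).eval (circleMap 0 1 θ))).eq_or_lt with h0 | h0
    · rw [← h0, Real.log_zero]
      have := Real.log_nonneg (one_le_two : (1 : ℝ) ≤ 2)
      positivity
    · rw [← Real.log_pow]
      exact Real.log_le_log h0 hn
  · have hMp := Polynomial.mahlerMeasure_pos_of_ne_zero hp0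
    have h1 : 0 ≤ Real.log (4 ^ k * (vecPoly v).mahlerMeasure) := Real.log_nonneg hM
    rw [Real.log_mul (by positivity) hMp.ne', Real.log_pow,
      Polynomial.mahlerMeasure_def_of_ne_zero hp0, Real.log_exp,
      show (4 : ℝ) = 2 ^ 2 by norm_num, Real.log_pow] at h1
    have hpi : 0 < 2 * Real.pi := by positivity
    have h2 := mul_le_mul_of_nonneg_left h1 hpi.le
    rw [mul_add, mul_inv_cancel_left₀ hpi.ne'] at h2
    push_cast at h2
    linarith

lemma ae_ne {p : Polynomial ℂ} (hp : p ≠ 0) :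
    ∀ᵐ θ : ℝ, p.eval (circleMap 0 1 θ) ≠ 0 := by
  have h : ((p.rootSet ℂ).Finite) := p.rootSet_finite ℂ
  have := (h.countable.preimage_circleMap 0 (one_ne_zero (α := ℝ))).measure_zero volume
  rw [ae_iff]
  refine measure_mono_null ?_ this
  intro θ hθ
  simp only [Set.mem_preimage]
  rw [Polynomial.mem_rootSet]
  refine ⟨hp, ?_⟩
  simpa using hθ

lemma exists_set (f : ℝ → ℝ) (hmeas : Measurable f)
    (hnonneg : ∀ᵐ θ ∂(volume.restrict (Set.Ioo (0 : ℝ) (2 * Real.pi))), 0 ≤ f θ)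
    (hne : ¬ (∀ᵐ θ ∂(volume.restrict (Set.Ioo (0 : ℝ) (2 * Real.pi))), f θ = 0)) :
    ∃ ε > (0 : ℝ), ∃ E : Set ℝ, MeasurableSet E ∧ E ⊆ Set.Ioc 0 (2 * Real.pi) ∧
      0 < volume.real E ∧ ∀ θ ∈ E, ε ≤ f θ := by
  by_contra! hcon
  apply hne
  have h : ∀ n : ℕ, ∀ᵐ θ ∂(volume.restrict (Set.Ioo (0 : ℝ) (2 * Real.pi))),
      f θ < 1 / ((n : ℝ) + 1) := by
    intro n
    by_contra hn
    have hE : MeasurableSet ({θ | 1 / ((n : ℝ) + 1) ≤ f θ} ∩ Set.Ioo 0 (2 * Real.pi)) :=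
      (measurableSet_le measurable_const hmeas).inter measurableSet_Ioo
    obtain ⟨θ, hθ, hlt⟩ := hcon (1 / ((n : ℝ) + 1)) (by positivity) _ hE
      (fun x hx => Set.Ioo_subset_Ioc_self hx.2) (by
        rw [measureReal_def, ENNReal.toReal_pos_iff]
        constructor
        · rw [pos_iff_ne_zero]
          intro h0
          apply hn
          rw [ae_iff, Measure.restrict_apply' measurableSet_Ioo]
          simpa using h0
        · exact (measure_mono Set.inter_subset_right).trans_lt measure_Ioo_lt_top)
    exact absurd hθ.1 (not_le.mpr hlt)
  filter_upwards [ae_all_iff.mpr h, hnonneg] with θ h1 h2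
  refine le_antisymm ?_ h2
  refine le_of_forall_pos_lt_add fun e he => ?_
  obtain ⟨n, hn⟩ := exists_nat_one_div_lt he
  linarith [h1 n]

/-- If `f ≥ 0` a.e. on the circle and `f` is not a.e. zero, then the smallest eigenvalue
of the Toeplitz matrix `T_k[a]` decays at most exponentially: there are `c > 0` and `k₀`
with `λ_min(T_k[a]) ≥ exp(-c k)` for all `k ≥ k₀`. -/
theorem toeplitz_lambdaMin_lower_bound (f : ℝ → ℝ) (hmeas : Measurable f)
    (hbd : ∃ C : ℝ, ∀ θ : ℝ, |f θ| ≤ C)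
    (hnonneg : ∀ᵐ θ ∂(volume.restrict (Set.Ioo (0 : ℝ) (2 * Real.pi))), 0 ≤ f θ)
    (hne : ¬ (∀ᵐ θ ∂(volume.restrict (Set.Ioo (0 : ℝ) (2 * Real.pi))), f θ = 0)) :
    ∃ c > (0 : ℝ), ∃ k₀ : ℕ, ∀ k ≥ k₀,
      Real.exp (-c * k) ≤ lambdaMin (toeplitzMatR f k) := by
  obtain ⟨ε, hε, E, hE, hEI, hm, hfE⟩ := exists_set f hmeas hnonneg hne
  set m := volume.real E with hmdef
  have hpi := Real.pi_pos
  have hpi2 : (0 : ℝ) ≤ 2 * Real.pi := by positivity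
  set A : ℝ := (2 * Real.pi)⁻¹ * (ε * m) with hA
  have hApos : 0 < A := by positivity
  have hl2 : 0 < Real.log 2 := Real.log_pos one_lt_two
  set D : ℝ := 12 * Real.pi * Real.log 2 / m with hD
  have hDpos : 0 < D := by positivity
  have hEfin : volume E ≠ ⊤ := ((measure_mono hEI).trans_lt measure_Ioc_lt_top).ne
  -- main estimate
  have main : ∀ k : ℕ, ∀ v : Fin (k + 1) → ℂ, (∑ i, ‖v i‖ ^ 2) = 1 →
      A * Real.exp (-(D * k)) ≤ (dotProduct (star v) ((toeplitzMatR f k).mulVec v)).re := by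
    intro k v hv
    obtain ⟨hp0, hup, hlow⟩ := log_bounds v hv
    rw [form_eq f hmeas hbd v, hA, mul_assoc]
    refine mul_le_mul_of_nonneg_left ?_ (by positivity)
    rw [intervalIntegral.integral_of_le hpi2]
    set P : ℝ → ℝ := fun θ => ‖(vecPoly v).eval (circleMap 0 1 θ)‖ with hP
    have hPc : Continuous P := by
      simp only [hP]; fun_prop
    have hLint : IntegrableOn (fun θ => Real.log (P θ)) (Set.Ioc 0 (2 * Real.pi)) := by
      have := (vecPoly v).intervalIntegrable_mahlerMeasure
      rwa [intervalIntegrable_iff_integrableOn_Ioc_of_le hpi2] at this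
    have hP2 : IntegrableOn (fun θ => P θ ^ 2) (Set.Ioc 0 (2 * Real.pi)) := by
      have : Continuous fun θ => P θ ^ 2 := by fun_prop
      exact (this.integrableOn_Icc).mono_set Set.Ioc_subset_Icc_self
    have hfP : IntegrableOn (fun θ => f θ * P θ ^ 2) (Set.Ioc 0 (2 * Real.pi)) := by
      obtain ⟨C, hC⟩ := hbd
      exact hP2.bdd_mul (c := C) hmeas.aestronglyMeasurable (by filter_upwards with x; exact hC x)
    -- log estimate on E
    set B : ℝ := k * Real.log 2 with hB
    have hB0 : 0 ≤ B := by positivity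
    have hlogE : -(6 * Real.pi * B) ≤ ∫ θ in E, Real.log (P θ) := by
      have hc : IntegrableOn (fun _ : ℝ => B) (Set.Ioc 0 (2 * Real.pi)) :=
        integrableOn_const measure_Ioc_lt_top.ne
      have h1 : ∫ θ in E, (B - Real.log (P θ)) ≤
          ∫ θ in Set.Ioc 0 (2 * Real.pi), (B - Real.log (P θ)) := by
        refine setIntegral_mono_set (hc.sub hLint) ?_ (Filter.Eventually.of_forall hEI)
        filter_upwards with θ
        simpa using hup θ
      rw [integral_sub (hc.mono_set hEI) (hLint.mono_set hEI), integral_sub hc hLint] at h1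
      rw [intervalIntegral.integral_of_le hpi2] at hlow
      simp only [setIntegral_const, smul_eq_mul] at h1
      rw [Real.volume_real_Ioc_of_le hpi2] at h1
      have : 0 ≤ volume.real E * B := by positivity
      nlinarith
    have hEP : m * Real.exp (-(D * k)) ≤ ∫ θ in E, P θ ^ 2 := by
      have hLE := hLint.mono_set hEI
      have h2 : ∫ θ in E, Real.exp (-(D * k)) * (1 + D * k + 2 * Real.log (P θ)) ≤
          ∫ θ in E, P θ ^ 2 := by
        refine integral_mono_ae ?_ (hP2.mono_set hEI) ?_
        · refine Integrable.const_mul ?_ _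
          refine Integrable.add ?_ (hLE.const_mul 2)
          exact integrableOn_const hEfin
        · filter_upwards [ae_restrict_of_ae (ae_ne hp0)] with θ hθ
          have hpos : 0 < P θ := norm_pos_iff.mpr hθ
          have h3 := Real.add_one_le_exp (D * k + 2 * Real.log (P θ))
          calc Real.exp (-(D * k)) * (1 + D * k + 2 * Real.log (P θ))
              ≤ Real.exp (-(D * k)) * Real.exp (D * k + 2 * Real.log (P θ)) := by
                gcongr; linarith
            _ = Real.exp (2 * Real.log (P θ)) := by
                rw [← Real.exp_add]; congr 1; ring
            _ = P θ ^ 2 := by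
                rw [two_mul, Real.exp_add, Real.exp_log hpos, sq]
      refine le_trans ?_ h2
      have hc1 : IntegrableOn (fun _ : ℝ => 1 + D * k) E := integrableOn_const hEfin
      rw [integral_const_mul, integral_add hc1 (hLE.const_mul 2),
        integral_const_mul, mul_comm m]
      refine mul_le_mul_of_nonneg_left ?_ (Real.exp_pos _).le
      simp only [setIntegral_const, smul_eq_mul]
      rw [← hmdef]
      have hDm : m * (D * k) = 12 * Real.pi * B := by
        rw [hD, hB]; field_simp
      rw [mul_add, hDm]
      linarith
    calc ε * m * Real.exp (-(D * k)) = ε * (m * Real.exp (-(D * k))) := by ring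
      _ ≤ ε * ∫ θ in E, P θ ^ 2 := by gcongr
      _ = ∫ θ in E, ε * P θ ^ 2 := by rw [integral_const_mul]
      _ ≤ ∫ θ in E, f θ * P θ ^ 2 := by
        refine setIntegral_mono_on ((hP2.mono_set hEI).const_mul _) (hfP.mono_set hEI) hE ?_
        intro θ hθ
        exact mul_le_mul_of_nonneg_right (hfE θ hθ) (by positivity)
      _ ≤ ∫ θ in Set.Ioc 0 (2 * Real.pi), f θ * P θ ^ 2 := by
        refine setIntegral_mono_set hfP ?_ (Filter.Eventually.of_forall hEI)
        rw [restrict_Ioo_eq_restrict_Ioc] at hnonneg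
        filter_upwards [hnonneg] with θ hθ
        exact mul_nonneg hθ (by positivity)
  refine ⟨D + |Real.log A|, by positivity, 1, fun k hk => ?_⟩
  refine le_csInf ?_ ?_
  · refine ⟨_, Pi.single 0 1, ?_, rfl⟩
    rw [Finset.sum_eq_single 0]
    · simp
    · intro b _ hb
      simp [hb]
    · simp
  · rintro t ⟨v, hv, rfl⟩
    refine le_trans ?_ (main k v hv)
    rw [← Real.exp_log hApos, ← Real.exp_add, Real.log_exp]
    refine Real.exp_le_exp.mpr ?_
    have hk1 : (1 : ℝ) ≤ k := by exact_mod_cast hk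
    have h1 := neg_abs_le (Real.log A)
    have h2 := mul_le_mul_of_nonneg_left hk1 (abs_nonneg (Real.log A))
    linarith
end

section
/- Let f be a bounded measurable real-valued function on the circle S¹ with f ≥ 0 almost everywhere, and suppose there is a closed set K ⊊ S¹ which is a finite union of nondegenerate closed arcs such that f = 0 almost everywhere on S¹ ∖ K and f > 0 almost everywhere on K. Let a_j be the Fourier coefficients of f. Then the smallest eigenvalue of the Hermitian Toeplitz matrix T_k[a] decays exponentially: there exist c > 0 and k₀ ∈ ℕ such that for every k ≥ k₀, λ_min(T_k[a]) ≤ exp(−c·k). -/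
open MeasureTheory Matrix

lemma toep_quad (f : ℝ → ℝ) (hmeas : Measurable f) (C : ℝ) (hC : ∀ θ : ℝ, |f θ| ≤ C)
    (k : ℕ) (v : Fin (k + 1) → ℂ) :
    dotProduct (star v) ((toeplitzMatR f k).mulVec v) =
      (1 / (2 * (Real.pi : ℂ))) * ∫ θ in (0 : ℝ)..(2 * Real.pi),
        (f θ : ℂ) * ((starRingEnd ℂ) (∑ q, v q * Complex.exp (Complex.I * ((q : ℕ) : ℂ) * θ)) *
          (∑ q, v q * Complex.exp (Complex.I * ((q : ℕ) : ℂ) * θ))) := by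
  have hint : ∀ g : ℝ → ℂ, Continuous g →
      IntervalIntegrable (fun θ => (f θ : ℂ) * g θ) volume 0 (2 * Real.pi) := by
    intro g hg
    have h1 : IntervalIntegrable (fun θ => (f θ : ℂ)) volume 0 (2 * Real.pi) := by
      rw [intervalIntegrable_iff]
      refine Measure.integrableOn_of_bounded (M := C) (by rw [Set.uIoc_of_le (by positivity)]; exact measure_Ioc_lt_top.ne) ?_ ?_
      · exact (Complex.measurable_ofReal.comp hmeas).aestronglyMeasurable
      · exact Filter.Eventually.of_forall fun θ => by simpa using hC θ
    exact h1.mul_continuousOn hg.continuousOn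
  have key : ∀ θ : ℝ, (f θ : ℂ) *
      ((starRingEnd ℂ) (∑ q, v q * Complex.exp (Complex.I * ((q : ℕ) : ℂ) * θ)) *
          (∑ q, v q * Complex.exp (Complex.I * ((q : ℕ) : ℂ) * θ))) =
      ∑ p : Fin (k+1), ∑ q : Fin (k+1), (f θ : ℂ) * (star (v p) * v q *
        Complex.exp (-(Complex.I * ((((p : ℕ) : ℤ) - ((q : ℕ) : ℤ) : ℤ) : ℂ) * (θ : ℂ)))) := by
    intro θ
    rw [map_sum, Finset.sum_mul_sum, Finset.mul_sum]
    refine Finset.sum_congr rfl fun p _ => ?_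
    rw [Finset.mul_sum]
    refine Finset.sum_congr rfl fun q _ => ?_
    congr 1
    have : Complex.exp (-(Complex.I * ((((p : ℕ) : ℤ) - ((q : ℕ) : ℤ) : ℤ) : ℂ) * (θ : ℂ))) =
      (starRingEnd ℂ) (Complex.exp (Complex.I * ((p : ℕ) : ℂ) * θ)) *
        Complex.exp (Complex.I * ((q : ℕ) : ℂ) * θ) := by
      rw [← Complex.exp_conj, ← Complex.exp_add]
      congr 1
      simp
      ring
    rw [this, map_mul]
    simp only [Complex.star_def]
    ring
  simp_rw [key]
  rw [intervalIntegral.integral_finsetSum, Finset.mul_sum]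
  · simp only [dotProduct, mulVec]
    refine Finset.sum_congr rfl fun p _ => ?_
    rw [intervalIntegral.integral_finsetSum, Finset.mul_sum, Finset.mul_sum]
    · refine Finset.sum_congr rfl fun q _ => ?_
      simp only [toeplitzMatR, Matrix.of_apply, fourierCoefR, Pi.star_apply]
      have : ∀ θ : ℝ, (f θ : ℂ) * (star (v p) * v q *
        Complex.exp (-(Complex.I * ((((p : ℕ) : ℤ) - ((q : ℕ) : ℤ) : ℤ) : ℂ) * (θ : ℂ)))) =
        (star (v p) * v q) * ((f θ : ℂ) *
        Complex.exp (-(Complex.I * ((((p : ℕ) : ℤ) - ((q : ℕ) : ℤ) : ℤ) : ℂ) * (θ : ℂ)))) := by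
        intro θ; ring
      simp_rw [this]
      rw [intervalIntegral.integral_const_mul]
      ring
    · intro q _
      exact hint _ (by fun_prop)
  · intro p _
    simp_rw [← Finset.mul_sum]
    exact hint _ (by fun_prop)

lemma toep_poly (k : ℕ) (s t θ : ℝ) :
    ‖∑ q : Fin (k+1), ((s : ℂ) * ((k.choose q : ℕ) : ℂ) *
        Complex.exp (-(Complex.I * ((q : ℕ) : ℂ) * t))) *
        Complex.exp (Complex.I * ((q : ℕ) : ℂ) * θ)‖ ^ 2 =
      s ^ 2 * (2 + 2 * Real.cos (θ - t)) ^ k := by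
  have h1 : ∑ q : Fin (k+1), ((s : ℂ) * ((k.choose q : ℕ) : ℂ) *
        Complex.exp (-(Complex.I * ((q : ℕ) : ℂ) * t))) *
        Complex.exp (Complex.I * ((q : ℕ) : ℂ) * θ) =
      s * (Complex.exp (((θ - t : ℝ) : ℂ) * Complex.I) + 1) ^ k := by
    rw [add_pow, Finset.mul_sum, Finset.sum_range]
    refine Finset.sum_congr rfl fun q _ => ?_
    rw [mul_assoc, ← Complex.exp_add, ← Complex.exp_nat_mul]
    have : -(Complex.I * ((q : ℕ) : ℂ) * t) + Complex.I * ((q : ℕ) : ℂ) * θ =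
      ((q : ℕ) : ℂ) * (((θ - t : ℝ) : ℂ) * Complex.I) := by
      push_cast; ring
    rw [this]
    simp
    ring
  rw [h1, norm_mul, norm_pow, mul_pow, ← pow_mul, mul_comm k 2, pow_mul]
  have hs : ‖(s : ℂ)‖ ^ 2 = s ^ 2 := by simp
  rw [hs]
  congr 2
  · rw [← Complex.normSq_eq_norm_sq, Complex.normSq_apply]
    simp only [Complex.add_re, Complex.add_im, Complex.exp_ofReal_mul_I_re,
      Complex.exp_ofReal_mul_I_im, Complex.one_re, Complex.one_im]
    nlinarith [Real.sin_sq_add_cos_sq (θ - t)]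

lemma toep_gap_cos (t δ θ : ℝ) (hδ : 0 < δ) (hδp : δ < Real.pi)
    (h0 : δ ≤ t) (h1 : t + δ ≤ 2 * Real.pi) (hθ0 : 0 ≤ θ) (hθ1 : θ ≤ 2 * Real.pi)
    (hd : δ ≤ |θ - t|) : Real.cos (θ - t) ≤ Real.cos δ := by
  rw [← Real.cos_abs (θ - t)]
  have hle : |θ - t| ≤ 2 * Real.pi - δ := by
    rw [abs_le]; constructor <;> linarith
  rcases le_total |θ - t| Real.pi with h | h
  · exact Real.cos_le_cos_of_nonneg_of_le_pi hδ.le h hd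
  · rw [← Real.cos_two_pi_sub]
    exact Real.cos_le_cos_of_nonneg_of_le_pi hδ.le (by linarith) (by linarith)

lemma toep_gap (K : Set ℝ) (hK : IsClosed K)
    (hproper : ¬ Set.Icc (0 : ℝ) (2 * Real.pi) ⊆ K) :
    ∃ t δ : ℝ, 0 < δ ∧ δ < Real.pi ∧ δ ≤ t ∧ t + δ ≤ 2 * Real.pi ∧
      ∀ θ, |θ - t| < δ → θ ∉ K := by
  have h1 : ∃ t ∈ Set.Ioo (0 : ℝ) (2 * Real.pi), t ∉ K := by
    by_contra! h
    apply hproper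
    rw [← closure_Ioo (by positivity)]
    exact closure_minimal h hK
  obtain ⟨t, ht, htK⟩ := h1
  obtain ⟨ε, hε, hb⟩ := Metric.isOpen_iff.1 hK.isOpen_compl t htK
  have hp := Real.pi_pos
  obtain ⟨h0, h1⟩ := ht
  refine ⟨t, min ε (min (Real.pi / 2) (min t (2 * Real.pi - t))), ?_, ?_, ?_, ?_, ?_⟩
  · simp only [lt_min_iff]; refine ⟨hε, ?_, h0, ?_⟩ <;> linarith
  · have : min ε (min (Real.pi / 2) (min t (2 * Real.pi - t))) ≤ Real.pi / 2 := by simp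
    linarith
  · simp
  · have : min ε (min (Real.pi / 2) (min t (2 * Real.pi - t))) ≤ 2 * Real.pi - t := by simp
    linarith
  · intro θ hθ
    exact hb (by rw [Metric.mem_ball, Real.dist_eq]; exact lt_of_lt_of_le hθ (min_le_left _ _))

lemma toep_decay (C ρ : ℝ) (h0 : 0 < ρ) (h1 : ρ < 1) :
    ∃ c > (0 : ℝ), ∃ k₀ : ℕ, ∀ k : ℕ, k ≥ k₀ → C * (2 * k) * ρ ^ k ≤ Real.exp (-c * k) := by
  set r := Real.sqrt ρ with hr
  have hr0 : 0 < r := Real.sqrt_pos.2 h0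
  have hr1 : r < 1 := by rw [hr, Real.sqrt_lt' one_pos]; simpa using h1
  have hrr : ρ = r * r := (Real.mul_self_sqrt h0.le).symm
  refine ⟨-Real.log r, by simpa using Real.log_neg hr0 hr1, ?_⟩
  have hl := (tendsto_self_mul_const_pow_of_lt_one hr0.le hr1).const_mul (2 * C)
  rw [mul_zero] at hl
  obtain ⟨k₀, hk⟩ := Filter.eventually_atTop.1 (hl.eventually (gt_mem_nhds one_pos))
  refine ⟨k₀, fun k hkk => ?_⟩
  have e : Real.exp (- -Real.log r * k) = r ^ k := by
    rw [neg_neg, mul_comm, Real.exp_nat_mul, Real.exp_log hr0]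
  rw [e, hrr, mul_pow]
  have := hk k hkk
  have hp : 0 < r ^ k := by positivity
  nlinarith

/-- If `f ≥ 0` a.e. vanishes a.e. outside a proper closed subset `K` of the circle which
is a finite union of nondegenerate closed arcs, and `f > 0` a.e. on `K`, then the smallest
eigenvalue of the Toeplitz matrix `T_k[a]` decays exponentially: there are `c > 0` and
`k₀` with `λ_min(T_k[a]) ≤ exp(-c k)` for all `k ≥ k₀`. -/
theorem toeplitz_lambdaMin_upper_bound (f : ℝ → ℝ) (hmeas : Measurable f)
    (hbd : ∃ C : ℝ, ∀ θ : ℝ, |f θ| ≤ C)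
    (hnonneg : ∀ᵐ θ ∂(volume.restrict (Set.Ioo (0 : ℝ) (2 * Real.pi))), 0 ≤ f θ)
    (K : Set ℝ) (hKsub : K ⊆ Set.Icc (0 : ℝ) (2 * Real.pi))
    (harcs : ∃ (N : ℕ) (a b : Fin N → ℝ), (∀ i, a i < b i) ∧ K = ⋃ i, Set.Icc (a i) (b i))
    (hproper : ¬ Set.Icc (0 : ℝ) (2 * Real.pi) ⊆ K)
    (hzero : ∀ᵐ θ ∂(volume.restrict (Set.Ioo (0 : ℝ) (2 * Real.pi) \ K)), f θ = 0)
    (hposK : ∀ᵐ θ ∂(volume.restrict K), 0 < f θ) :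
    ∃ c > (0 : ℝ), ∃ k₀ : ℕ, ∀ k ≥ k₀,
      lambdaMin (toeplitzMatR f k) ≤ Real.exp (-c * k) := by
  obtain ⟨C, hC⟩ := hbd
  obtain ⟨N, a, b, hab, rfl⟩ := harcs
  have hC0 : 0 ≤ C := (abs_nonneg _).trans (hC 0)
  obtain ⟨t, δ, hδ, hδp, hδ0, hδ1, hgap⟩ :=
    toep_gap _ (isClosed_iUnion_of_finite fun i => isClosed_Icc) hproper
  set ρ := (1 + Real.cos δ) / 2 with hρ
  have hcos1 : Real.cos δ < 1 := by
    have := Real.cos_lt_cos_of_nonneg_of_le_pi le_rfl hδp.le hδ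
    simpa using this
  have hcos2 : -1 < Real.cos δ := by
    have := Real.cos_lt_cos_of_nonneg_of_le_pi hδ.le le_rfl hδp
    simpa using this
  obtain ⟨c, hc, k₀, hk₀⟩ := toep_decay C ρ (by rw [hρ]; linarith) (by rw [hρ]; linarith)
  refine ⟨c, hc, max k₀ 1, fun k hk => ?_⟩
  have hk1 : 0 < k := lt_of_lt_of_le one_pos ((le_max_right _ _).trans hk)
  refine le_trans ?_ (hk₀ k ((le_max_left _ _).trans hk))
  have hrhs : 0 ≤ C * (2 * k) * ρ ^ k := by
    have : 0 < ρ := by rw [hρ]; linarith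
    positivity
  unfold lambdaMin
  by_cases hB : BddBelow {t : ℝ | ∃ v : Fin (k + 1) → ℂ, (∑ i, ‖v i‖ ^ 2) = 1 ∧
    t = (dotProduct (star v) ((toeplitzMatR f k).mulVec v)).re}
  swap
  · rw [Real.sInf_of_not_bddBelow hB]; exact hrhs
  set B : ℝ := (k.centralBinom : ℝ) with hBdef
  have hBpos : 0 < B := by rw [hBdef]; exact_mod_cast Nat.centralBinom_pos k
  set s : ℝ := (Real.sqrt B)⁻¹ with hs
  have hs2 : s ^ 2 = B⁻¹ := by rw [hs, inv_pow, Real.sq_sqrt hBpos.le]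
  set v : Fin (k + 1) → ℂ := fun q => (s : ℂ) * ((k.choose q : ℕ) : ℂ) *
        Complex.exp (-(Complex.I * ((q : ℕ) : ℂ) * t)) with hv
  have hnorm : (∑ i, ‖v i‖ ^ 2) = 1 := by
    have e : ∀ i : Fin (k + 1), ‖v i‖ ^ 2 = s ^ 2 * ((k.choose i ^ 2 : ℕ) : ℝ) := by
      intro i
      have : ‖Complex.exp (-(Complex.I * ((i : ℕ) : ℂ) * t))‖ = 1 := by
        rw [Complex.norm_exp]; simp
      simp only [hv, norm_mul, this, mul_one, mul_pow]
      simp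
    simp_rw [e]
    rw [← Finset.mul_sum, ← Nat.cast_sum, ← Finset.sum_range (fun i => k.choose i ^ 2),
      Nat.sum_range_choose_sq, ← Nat.centralBinom_eq_two_mul_choose, hs2]
    exact inv_mul_cancel₀ hBpos.ne'
  refine (csInf_le hB ⟨v, hnorm, rfl⟩).trans ?_
  refine (Complex.re_le_norm _).trans ?_
  rw [toep_quad f hmeas C hC k v, norm_mul]
  have hbound : ∀ᵐ θ : ℝ, θ ∈ Set.uIoc 0 (2 * Real.pi) →
      ‖(f θ : ℂ) * ((starRingEnd ℂ) (∑ q, v q * Complex.exp (Complex.I * ((q : ℕ) : ℂ) * θ)) *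
          (∑ q, v q * Complex.exp (Complex.I * ((q : ℕ) : ℂ) * θ)))‖ ≤
        C * (B⁻¹ * (4 * ρ) ^ k) := by
    have hz := (ae_restrict_iff' (measurableSet_Ioo.diff
      (isClosed_iUnion_of_finite (fun i => isClosed_Icc (a := a i) (b := b i))).measurableSet)).1
        hzero
    have hne : ∀ᵐ θ : ℝ, θ ≠ 2 * Real.pi := by
      simp [ae_iff]
    filter_upwards [hz, hne] with θ hθ hθne hmem
    rw [Set.uIoc_of_le (by positivity)] at hmem
    have hpos : 0 ≤ C * (B⁻¹ * (4 * ρ) ^ k) := by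
      have : 0 < ρ := by rw [hρ]; linarith
      positivity
    by_cases hd : |θ - t| < δ
    · rw [hθ ⟨⟨hmem.1, lt_of_le_of_ne hmem.2 hθne⟩, hgap θ hd⟩]
      simpa using hpos
    · have hcc := toep_gap_cos t δ θ hδ hδp hδ0 hδ1 hmem.1.le hmem.2 (not_lt.1 hd)
      rw [norm_mul, norm_mul, RCLike.norm_conj, ← sq, toep_poly k s t θ, hs2,
        Complex.norm_real]
      have h2 : 0 ≤ 2 + 2 * Real.cos (θ - t) := by linarith [Real.neg_one_le_cos (θ - t)]
      have h3 : 2 + 2 * Real.cos (θ - t) ≤ 4 * ρ := by rw [hρ]; linarith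
      have h4 : ‖f θ‖ ≤ C := hC θ
      gcongr
  have hI := intervalIntegral.norm_integral_le_of_norm_le_const_ae hbound
  have hn : ‖(1 / (2 * (Real.pi : ℂ)))‖ = 1 / (2 * Real.pi) := by
    simp [abs_of_pos Real.pi_pos]
  rw [hn]
  have h2p : 0 < 2 * Real.pi := by positivity
  rw [sub_zero, abs_of_pos h2p] at hI
  have h4 : (4 : ℝ) ^ k ≤ 2 * k * B := by
    rw [hBdef]; exact_mod_cast Nat.four_pow_le_two_mul_self_mul_centralBinom k hk1
  have h5 : B⁻¹ * 4 ^ k ≤ 2 * k := by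
    rw [inv_mul_le_iff₀ hBpos]; linarith
  have hρ0 : 0 < ρ := by rw [hρ]; linarith
  calc _ ≤ 1 / (2 * Real.pi) * (C * (B⁻¹ * (4 * ρ) ^ k) * (2 * Real.pi)) := by gcongr
    _ = C * (B⁻¹ * 4 ^ k) * ρ ^ k := by rw [mul_pow]; field_simp
    _ ≤ _ := by gcongr
end

section
/- Let A, B ∈ M_n(ℂ) be positive definite Hermitian matrices and let μ₁, …, μ_n > 0 be the eigenvalues of A^{−1/2} B A^{−1/2}. Then the operator norm of log A − log B satisfies ‖log A − log B‖ ≤ max_{1 ≤ i ≤ n} |log μᵢ|. -/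
open Matrix
open scoped ComplexOrder Matrix.Norms.L2Operator

/-- The Hermitian logarithm of a (positive definite Hermitian) matrix, via the
continuous functional calculus. -/
noncomputable def matLog {n : ℕ} (A : Matrix (Fin n) (Fin n) ℂ) : Matrix (Fin n) (Fin n) ℂ :=
  cfc Real.log A

/-- The inverse square root `A^{-1/2}` of a (positive definite Hermitian) matrix, via the
continuous functional calculus. -/
noncomputable def matInvSqrt {n : ℕ} (A : Matrix (Fin n) (Fin n) ℂ) :
    Matrix (Fin n) (Fin n) ℂ :=
  cfc (fun t : ℝ => (Real.sqrt t)⁻¹) A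

open scoped MatrixOrder in
theorem opNorm_log_sub_log_le_aux (n : ℕ) (A B : Matrix (Fin n) (Fin n) ℂ)
    (hA : A.PosDef) (hB : B.PosDef)
    (hC : (matInvSqrt A * B * matInvSqrt A).IsHermitian) :
    ‖matLog A - matLog B‖ ≤ ⨆ i : Fin n, |Real.log (hC.eigenvalues i)| := by
  set s : ℝ := ⨆ i : Fin n, |Real.log (hC.eigenvalues i)| with hs
  have hs0 : 0 ≤ s := Real.iSup_nonneg fun i => abs_nonneg _
  have hsi : ∀ i, |Real.log (hC.eigenvalues i)| ≤ s := fun i =>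
    le_ciSup (f := fun i => |Real.log (hC.eigenvalues i)|) (Set.finite_range _).bddAbove i
  have hAs : IsStrictlyPositive A := Matrix.isStrictlyPositive_iff_posDef.mpr hA
  have hBs : IsStrictlyPositive B := Matrix.isStrictlyPositive_iff_posDef.mpr hB
  have hAsa : IsSelfAdjoint A := hAs.isSelfAdjoint
  have hpos : ∀ x ∈ spectrum ℝ A, 0 < x := fun x hx => hAs.spectrum_pos hx
  have hfin : (spectrum ℝ A).Finite := Matrix.finite_real_spectrum
  set S := matInvSqrt A with hSdef
  set R : Matrix (Fin n) (Fin n) ℂ := cfc Real.sqrt A with hRdef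
  have hc1 : ContinuousOn Real.sqrt (spectrum ℝ A) := hfin.continuousOn _
  have hc2 : ContinuousOn (fun t : ℝ => (Real.sqrt t)⁻¹) (spectrum ℝ A) := hfin.continuousOn _
  have hRS : R * S = 1 := by
    rw [hRdef, hSdef, matInvSqrt, ← cfc_mul _ _ A hc1 hc2, ← cfc_one ℝ A]
    refine cfc_congr fun x hx => ?_
    exact mul_inv_cancel₀ (Real.sqrt_pos.mpr (hpos x hx)).ne'
  have hSR : S * R = 1 := by
    rw [hRdef, hSdef, matInvSqrt, ← cfc_mul _ _ A hc2 hc1, ← cfc_one ℝ A]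
    refine cfc_congr fun x hx => ?_
    exact inv_mul_cancel₀ (Real.sqrt_pos.mpr (hpos x hx)).ne'
  have hRR : R * R = A := by
    rw [hRdef, ← cfc_mul _ _ A hc1 hc1]
    conv_rhs => rw [← cfc_id ℝ A]
    refine cfc_congr fun x hx => ?_
    exact Real.mul_self_sqrt (hpos x hx).le
  have hRsa : IsSelfAdjoint R := cfc_predicate _ _
  have hSsa : IsSelfAdjoint S := cfc_predicate _ _
  set C := S * B * S with hCdef
  have hCB : R * C * R = B := by
    calc R * C * R = (R * S) * B * (S * R) := by rw [hCdef]; noncomm_ring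
      _ = B := by rw [hRS, hSR]; simp
  have hSu : IsUnit S := ⟨⟨S, R, hSR, hRS⟩, rfl⟩
  have hC0 : IsStrictlyPositive C := by
    refine IsUnit.isStrictlyPositive ((hSu.mul hBs.isUnit).mul hSu) ?_
    exact hSsa.conjugate_nonneg hBs.nonneg
  have hCsp : ∀ x ∈ spectrum ℝ C, Real.exp (-s) ≤ x ∧ x ≤ Real.exp s := by
    intro x hx
    have hx0 : 0 < x := hC0.spectrum_pos hx
    have hx' := hx
    rw [hC.spectrum_real_eq_range_eigenvalues] at hx'
    obtain ⟨i, rfl⟩ := hx'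
    have := abs_le.mp (hsi i)
    exact ⟨(Real.le_log_iff_exp_le hx0).mp this.1, (Real.log_le_iff_le_exp hx0).mp this.2⟩
  have hCsa : IsSelfAdjoint C := hC
  have h1 : algebraMap ℝ _ (Real.exp (-s)) ≤ C :=
    (algebraMap_le_iff_le_spectrum (a := C) hCsa).mpr fun x hx => (hCsp x hx).1
  have h2 : C ≤ algebraMap ℝ _ (Real.exp s) :=
    (le_algebraMap_iff_spectrum_le (a := C) hCsa).mpr fun x hx => (hCsp x hx).2
  have hconj : ∀ r : ℝ, R * algebraMap ℝ _ r * R = r • A := by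
    intro r
    rw [Algebra.algebraMap_eq_smul_one, mul_smul_comm, mul_one, smul_mul_assoc, hRR]
  have h3 : Real.exp (-s) • A ≤ B := by
    have := hRsa.conjugate_le_conjugate h1
    rwa [hconj, hCB] at this
  have h4 : B ≤ Real.exp s • A := by
    have := hRsa.conjugate_le_conjugate h2
    rwa [hconj, hCB] at this
  have hlog : ∀ r : ℝ, CFC.log (Real.exp r • A) = algebraMap ℝ _ r + CFC.log A := by
    intro r
    rw [CFC.log_smul' A (Real.exp_pos r) hAs, Real.log_exp]
  have h5 := CFC.log_le_log h3 (hAs.smul (Real.exp_pos _))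
  have h6 := CFC.log_le_log h4 hBs
  rw [hlog] at h5 h6
  change ‖CFC.log A - CFC.log B‖ ≤ s
  set D := CFC.log A - CFC.log B with hD
  have hDsa : IsSelfAdjoint D := IsSelfAdjoint.log.sub IsSelfAdjoint.log
  have h7 : D ≤ algebraMap ℝ _ s := by
    rw [map_neg] at h5
    rw [hD, sub_le_iff_le_add]
    rwa [neg_add_le_iff_le_add] at h5
  have h8 : algebraMap ℝ _ (-s) ≤ D := by
    rw [map_neg, hD, neg_le_sub_iff_le_add, add_comm]
    exact h6
  have h7' := (le_algebraMap_iff_spectrum_le (a := D) hDsa).mp h7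
  have h8' := (algebraMap_le_iff_le_spectrum (a := D) hDsa).mp h8
  rw [← cfc_id ℝ D]
  refine norm_cfc_le hs0 fun x hx => ?_
  exact abs_le.mpr ⟨h8' x hx, h7' x hx⟩

/-- **Exponential metric increasing property, operator norm case.** For positive definite
Hermitian matrices `A` and `B`, the operator norm of `log A − log B` is at most the
maximum of `|log μᵢ|` over the eigenvalues `μ₁, …, μ_n` of `A^{-1/2} B A^{-1/2}`. -/
theorem opNorm_log_sub_log_le (n : ℕ) (A B : Matrix (Fin n) (Fin n) ℂ)
    (hA : A.PosDef) (hB : B.PosDef)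
    (hC : (matInvSqrt A * B * matInvSqrt A).IsHermitian) :
    ‖matLog A - matLog B‖ ≤ ⨆ i : Fin n, |Real.log (hC.eigenvalues i)| :=
  opNorm_log_sub_log_le_aux n A B hA hB hC
end
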